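/- For λ > 3/2, c > 0 and y ∈ ℝ³ with |y| < c, one has ∫_{ℝ³} (√(1 + |u|²/c²) - y·u/c²)^{-2λ} du = c³ π^{3/2} Γ(λ-3/2) / ((1-|y/c|²)^{λ+1/2} Γ(λ)). -/

import Mathlib

open Finset Real MeasureTheory

/-- The substitution `x = m * sinh θ` in a Lebesgue integral over the real line. -/
theorem lintegral_eq_lintegral_cosh_mul_comp_sinh {m : ℝ} (hm : 0 < m) (g : ℝ → ENNReal) :
    ∫⁻ x, g x = ∫⁻ θ : ℝ, ENNReal.ofReal (m * cosh θ) * g (m * sinh θ) := by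
  have hsurj : Function.Surjective fun θ => m * sinh θ :=
    (mul_left_surjective₀ hm.ne').comp sinh_surjective
  have hinj : Function.Injective fun θ => m * sinh θ :=
    (mul_right_injective₀ hm.ne').comp sinh_injective
  have h := lintegral_image_eq_lintegral_abs_deriv_mul (s := Set.univ)
    (f := fun θ => m * sinh θ) (f' := fun θ => m * cosh θ) MeasurableSet.univ
    (fun θ _ => ((hasDerivAt_sinh θ).const_mul m).hasDerivWithinAt) hinj.injOn g
  simpa only [Set.image_univ, hsurj.range_eq, Measure.restrict_univ, abs_mul, abs_of_pos hm,
    abs_of_pos (cosh_pos _)] using h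

theorem sqrt_sq_add_sq_mul_sinh {m : ℝ} (hm : 0 < m) (θ : ℝ) :
    √(m ^ 2 + (m * sinh θ) ^ 2) = m * cosh θ := by
  rw [show m ^ 2 + (m * sinh θ) ^ 2 = (m * cosh θ) ^ 2 by rw [mul_pow, mul_pow, cosh_sq]; ring]
  exact sqrt_sq (by positivity)

/-- A one-dimensional boost of rapidity `η` multiplies the integral of a power of the energy
`√(m ^ 2 + x ^ 2)` by a power of the Lorentz factor `cosh η`. -/
theorem lintegral_boost_tanh {m : ℝ} (hm : 0 < m) (η p : ℝ) :
    ∫⁻ x : ℝ, ENNReal.ofReal ((√(m ^ 2 + x ^ 2) - tanh η * x) ^ (-p)) =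
      ENNReal.ofReal (cosh η ^ (p + 1)) *
        ∫⁻ x : ℝ, ENNReal.ofReal (√(m ^ 2 + x ^ 2) ^ (-p)) := by
  rw [lintegral_eq_lintegral_cosh_mul_comp_sinh hm,
    lintegral_eq_lintegral_cosh_mul_comp_sinh hm
      fun x => ENNReal.ofReal (√(m ^ 2 + x ^ 2) ^ (-p))]
  simp_rw [sqrt_sq_add_sq_mul_sinh hm]
  have hη := cosh_pos η
  have hmeas (a : ℝ) : Measurable fun θ : ℝ =>
      ENNReal.ofReal (m * cosh (θ + a)) * ENNReal.ofReal ((m * cosh θ) ^ (-p)) := by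
    fun_prop
  set J := ∫⁻ θ : ℝ, ENNReal.ofReal (m * cosh θ) * ENNReal.ofReal ((m * cosh θ) ^ (-p))
  set K := ∫⁻ θ : ℝ, ENNReal.ofReal (m * cosh (θ + η)) * ENNReal.ofReal ((m * cosh θ) ^ (-p))
    with hK
  have hshift : ∫⁻ θ : ℝ, ENNReal.ofReal (m * cosh θ) *
      ENNReal.ofReal ((m * cosh θ - tanh η * (m * sinh θ)) ^ (-p)) =
      ENNReal.ofReal (cosh η ^ p) * K := by
    rw [← lintegral_add_right_eq_self _ η, ← lintegral_const_mul _ (hmeas η)]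
    refine lintegral_congr fun θ => ?_
    have hθ := cosh_pos θ
    have : m * cosh (θ + η) - tanh η * (m * sinh (θ + η)) = m * cosh θ * (cosh η)⁻¹ := by
      rw [cosh_add, sinh_add, tanh_eq_sinh_div_cosh]
      field_simp
      linear_combination cosh θ * cosh_sq η
    rw [this, mul_rpow (by positivity) (by positivity), inv_rpow hη.le, rpow_neg hη.le, inv_inv,
      mul_comm _ (cosh η ^ p), ENNReal.ofReal_mul (p := cosh η ^ p) (by positivity), mul_left_comm]
  have hneg : K = ∫⁻ θ : ℝ, ENNReal.ofReal (m * cosh (θ + -η)) *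
      ENNReal.ofReal ((m * cosh θ) ^ (-p)) := by
    rw [hK, ← (Measure.measurePreserving_neg (volume : Measure ℝ)).lintegral_comp (hmeas η)]
    refine lintegral_congr fun θ => ?_
    rw [cosh_neg θ, ← cosh_neg (-θ + η)]
    ring_nf
  have htwo : 2 * K = 2 * (ENNReal.ofReal (cosh η) * J) := by
    have hsum : K + K = ENNReal.ofReal (2 * cosh η) * J := by
      nth_rewrite 2 [hneg]
      rw [hK, ← lintegral_add_left (hmeas η), ← lintegral_const_mul _ (by simpa using hmeas 0)]
      refine lintegral_congr fun θ => ?_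
      rw [← add_mul, ← mul_assoc, ← ENNReal.ofReal_add (by positivity) (by positivity),
        ← ENNReal.ofReal_mul (p := 2 * cosh η) (by positivity), cosh_add, cosh_add, cosh_neg,
        sinh_neg]
      congr 2
      ring
    rw [two_mul, hsum, ENNReal.ofReal_mul (by norm_num), ENNReal.ofReal_ofNat, mul_assoc]
  rw [hshift, (ENNReal.mul_right_inj (by norm_num) (by norm_num)).1 htwo, ← mul_assoc,
    ← ENNReal.ofReal_mul (by positivity), rpow_add hη, rpow_one]

theorem lintegral_boost {m b : ℝ} (hm : 0 < m) (hb : |b| < 1) (p : ℝ) :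
    ∫⁻ x : ℝ, ENNReal.ofReal ((√(m ^ 2 + x ^ 2) - b * x) ^ (-p)) =
      ENNReal.ofReal ((1 - b ^ 2) ^ (-((p + 1) / 2))) *
        ∫⁻ x : ℝ, ENNReal.ofReal (√(m ^ 2 + x ^ 2) ^ (-p)) := by
  have hb' : b ∈ Set.Ioo (-1) 1 := abs_lt.1 hb
  have hpos : 0 < 1 - b ^ 2 := by nlinarith [hb'.1, hb'.2]
  have h := lintegral_boost_tanh hm (artanh b) p
  rw [tanh_artanh hb', cosh_artanh hb', one_div, ← rpow_neg_one, sqrt_eq_rpow,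
    ← rpow_mul hpos.le, ← rpow_mul hpos.le] at h
  rw [h]
  ring_nf

theorem lintegral_pi_boost {n : ℕ} {c b : ℝ} (hc : 0 < c) (hb : |b| < 1) (p : ℝ) :
    ∫⁻ u : Fin (n + 1) → ℝ, ENNReal.ofReal ((√(c ^ 2 + ∑ i, u i ^ 2) - b * u 0) ^ (-p)) =
      ENNReal.ofReal ((1 - b ^ 2) ^ (-((p + 1) / 2))) *
        ∫⁻ u : Fin (n + 1) → ℝ, ENNReal.ofReal (√(c ^ 2 + ∑ i, u i ^ 2) ^ (-p)) := by
  have hslice (a : ℝ) :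
      ∫⁻ u : Fin (n + 1) → ℝ, ENNReal.ofReal ((√(c ^ 2 + ∑ i, u i ^ 2) - a * u 0) ^ (-p)) =
        ∫⁻ v : Fin n → ℝ, ∫⁻ x : ℝ,
          ENNReal.ofReal ((√(√(c ^ 2 + ∑ i, v i ^ 2) ^ 2 + x ^ 2) - a * x) ^ (-p)) := by
    have hmp := (volume_preserving_piFinSuccAbove (fun _ : Fin (n + 1) => ℝ) 0).symm
    rw [← hmp.lintegral_comp (by fun_prop), Measure.volume_eq_prod,
      lintegral_prod_symm _ (by fun_prop)]
    refine lintegral_congr fun v => lintegral_congr fun x => ?_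
    rw [sq_sqrt (by positivity)]
    simp [MeasurableEquiv.piFinSuccAbove, Fin.insertNthEquiv, Fin.sum_univ_succ]
    ring_nf
  have hzero := hslice 0
  simp only [zero_mul, sub_zero] at hzero
  rw [hslice, hzero, ← lintegral_const_mul']
  · exact lintegral_congr fun v => lintegral_boost (by positivity) hb p
  · exact ENNReal.ofReal_ne_top

theorem lintegral_euclideanSpace_boost {n : ℕ} {c : ℝ} (hc : 0 < c)
    {v : EuclideanSpace ℝ (Fin (n + 1))} (hv : ‖v‖ < 1) (p : ℝ) :
    ∫⁻ u : EuclideanSpace ℝ (Fin (n + 1)),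
        ENNReal.ofReal ((√(c ^ 2 + ‖u‖ ^ 2) - inner ℝ v u) ^ (-p)) =
      ENNReal.ofReal ((1 - ‖v‖ ^ 2) ^ (-((p + 1) / 2))) *
        ∫⁻ u : EuclideanSpace ℝ (Fin (n + 1)), ENNReal.ofReal (√(c ^ 2 + ‖u‖ ^ 2) ^ (-p)) := by
  set w : EuclideanSpace ℝ (Fin (n + 1)) := EuclideanSpace.single 0 ‖v‖ with hw
  have hnorm : ‖v‖ = ‖w‖ := by simp [hw]
  set R := Submodule.reflection (Submodule.span ℝ {v - w})ᗮ
  have hR : R v = w := Submodule.reflection_sub hnorm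
  have hrot : ∫⁻ u : EuclideanSpace ℝ (Fin (n + 1)),
        ENNReal.ofReal ((√(c ^ 2 + ‖u‖ ^ 2) - inner ℝ v u) ^ (-p)) =
      ∫⁻ u : EuclideanSpace ℝ (Fin (n + 1)),
        ENNReal.ofReal ((√(c ^ 2 + ‖u‖ ^ 2) - inner ℝ w u) ^ (-p)) := by
    rw [← R.measurePreserving.lintegral_comp (f := fun u =>
      ENNReal.ofReal ((√(c ^ 2 + ‖u‖ ^ 2) - inner ℝ w u) ^ (-p))) (by fun_prop)]
    refine lintegral_congr fun u => ?_
    rw [← hR, R.inner_map_map, R.norm_map]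
  have htoLp := PiLp.volume_preserving_toLp (Fin (n + 1))
  rw [hrot, ← htoLp.lintegral_comp (by fun_prop), ← htoLp.lintegral_comp (by fun_prop)]
  have h := lintegral_pi_boost (n := n) hc (b := ‖v‖) (by rwa [abs_norm]) p
  simpa [hw, EuclideanSpace.norm_sq_eq, EuclideanSpace.inner_single_left] using h

theorem lintegral_rpow_mul_exp_neg_mul_Ioi {a r : ℝ} (ha : 0 < a) (hr : 0 < r) :
    ∫⁻ t in Set.Ioi (0 : ℝ), ENNReal.ofReal (t ^ (a - 1) * exp (-(r * t))) =
      ENNReal.ofReal (r ^ (-a) * Gamma a) := by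
  have h := integral_rpow_mul_exp_neg_mul_Ioi ha hr
  have hG := Gamma_pos_of_pos ha
  have hint : IntegrableOn (fun t : ℝ => t ^ (a - 1) * exp (-(r * t))) (Set.Ioi 0) :=
    .of_integral_ne_zero (by rw [h]; positivity)
  rw [← ofReal_integral_eq_lintegral_ofReal hint, h, one_div, inv_rpow hr.le, rpow_neg hr.le]
  filter_upwards [self_mem_ae_restrict measurableSet_Ioi] with t ht
  have : 0 < t := ht
  simp only [Pi.zero_apply]
  positivity

theorem lintegral_exp_neg_mul_sq_norm {V : Type*} [NormedAddCommGroup V] [InnerProductSpace ℝ V]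
    [FiniteDimensional ℝ V] [MeasurableSpace V] [BorelSpace V] {t : ℝ} (ht : 0 < t) :
    ∫⁻ u : V, ENNReal.ofReal (exp (-t * ‖u‖ ^ 2)) =
      ENNReal.ofReal ((π / t) ^ (Module.finrank ℝ V / 2 : ℝ)) := by
  have h := GaussianFourier.integral_rexp_neg_mul_sq_norm (V := V) ht
  have hint : Integrable fun u : V => exp (-t * ‖u‖ ^ 2) :=
    .of_integral_ne_zero (by rw [h]; positivity)
  rw [← ofReal_integral_eq_lintegral_ofReal hint (.of_forall fun u => (exp_pos _).le), h]

theorem lintegral_sq_add_sq_norm_rpow_neg {V : Type*} [NormedAddCommGroup V]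
    [InnerProductSpace ℝ V] [FiniteDimensional ℝ V] [MeasurableSpace V] [BorelSpace V]
    {c lam : ℝ} (hc : 0 < c) (hlam : (Module.finrank ℝ V / 2 : ℝ) < lam) :
    ∫⁻ u : V, ENNReal.ofReal ((c ^ 2 + ‖u‖ ^ 2) ^ (-lam)) =
      ENNReal.ofReal (π ^ (Module.finrank ℝ V / 2 : ℝ) *
        (c ^ 2) ^ (-(lam - Module.finrank ℝ V / 2)) *
          Gamma (lam - Module.finrank ℝ V / 2) / Gamma lam) := by
  set d : ℝ := Module.finrank ℝ V / 2 with hd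
  have hd0 : 0 ≤ d := by positivity
  have hlam0 : 0 < lam := hd0.trans_lt hlam
  have hG := Gamma_pos_of_pos hlam0
  have hGamma (u : V) : ENNReal.ofReal (Gamma lam) * ENNReal.ofReal ((c ^ 2 + ‖u‖ ^ 2) ^ (-lam)) =
      ∫⁻ t in Set.Ioi (0 : ℝ),
        ENNReal.ofReal (t ^ (lam - 1) * exp (-((c ^ 2 + ‖u‖ ^ 2) * t))) := by
    rw [lintegral_rpow_mul_exp_neg_mul_Ioi hlam0 (by positivity), ← ENNReal.ofReal_mul hG.le,
      mul_comm]
  have hswap : ENNReal.ofReal (Gamma lam) *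
      ∫⁻ u : V, ENNReal.ofReal ((c ^ 2 + ‖u‖ ^ 2) ^ (-lam)) =
      ENNReal.ofReal (π ^ d * ((c ^ 2) ^ (-(lam - d)) * Gamma (lam - d))) := by
    rw [← lintegral_const_mul' _ _ ENNReal.ofReal_ne_top]
    simp_rw [hGamma]
    rw [lintegral_lintegral_swap (by fun_prop), ENNReal.ofReal_mul (by positivity),
      ← lintegral_rpow_mul_exp_neg_mul_Ioi (sub_pos.2 hlam) (by positivity),
      ← lintegral_const_mul' _ _ ENNReal.ofReal_ne_top]
    refine setLIntegral_congr_fun measurableSet_Ioi fun t ht => ?_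
    have ht : 0 < t := ht
    calc ∫⁻ u : V, ENNReal.ofReal (t ^ (lam - 1) * exp (-((c ^ 2 + ‖u‖ ^ 2) * t)))
        = ∫⁻ u : V, ENNReal.ofReal (t ^ (lam - 1) * exp (-(c ^ 2 * t))) *
            ENNReal.ofReal (exp (-t * ‖u‖ ^ 2)) := by
          refine lintegral_congr fun u => ?_
          rw [← ENNReal.ofReal_mul (by positivity), mul_assoc, ← exp_add]
          ring_nf
      _ = ENNReal.ofReal (π ^ d) *
            ENNReal.ofReal (t ^ (lam - d - 1) * exp (-(c ^ 2 * t))) := by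
          rw [lintegral_const_mul' _ _ ENNReal.ofReal_ne_top, lintegral_exp_neg_mul_sq_norm ht,
            ← ENNReal.ofReal_mul (by positivity), ← ENNReal.ofReal_mul (by positivity), ← hd,
            div_rpow pi_pos.le ht.le, show lam - d - 1 = lam - 1 - d by ring,
            rpow_sub ht (lam - 1)]
          ring_nf
  rw [← ENNReal.mul_right_inj (ENNReal.ofReal_pos.2 hG).ne' ENNReal.ofReal_ne_top, hswap,
    ← ENNReal.ofReal_mul hG.le]
  congr 1
  field_simp

theorem normalization_integral_boosted (lam c : ℝ) (hlam : 3 / 2 < lam) (hc : 0 < c)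
    (y : Fin 3 → ℝ) (hy : Real.sqrt (∑ i, y i ^ 2) < c) :
    (∫ u : Fin 3 → ℝ,
        (Real.sqrt (1 + (∑ i, u i ^ 2) / c ^ 2) - (∑ i, y i * u i) / c ^ 2)
          ^ (-(2 * lam))) =
      c ^ 3 * Real.pi ^ ((3 : ℝ) / 2) * Real.Gamma (lam - 3 / 2) /
        ((1 - (∑ i, y i ^ 2) / c ^ 2) ^ (lam + 1 / 2) * Real.Gamma lam) := by
  set v : EuclideanSpace ℝ (Fin 3) := WithLp.toLp 2 fun i => y i / c with hv
  have hvsq : ‖v‖ ^ 2 = (∑ i, y i ^ 2) / c ^ 2 := by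
    simp [hv, EuclideanSpace.norm_sq_eq, div_pow, Finset.sum_div]
  have hvlt : ‖v‖ < 1 := by
    have h := (sqrt_lt' hc).1 hy
    rw [← sq_lt_one_iff₀ (norm_nonneg v), hvsq]
    exact (div_lt_one (by positivity)).2 h
  have hpos : 0 < 1 - ‖v‖ ^ 2 := by nlinarith [norm_nonneg v]
  have hG := Gamma_pos_of_pos (show 0 < lam by linarith)
  have hG' := Gamma_pos_of_pos (sub_pos.2 hlam)
  have henergy (u : EuclideanSpace ℝ (Fin 3)) : 0 ≤ √(c ^ 2 + ‖u‖ ^ 2) - inner ℝ v u := by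
    have h₁ : ‖u‖ ≤ √(c ^ 2 + ‖u‖ ^ 2) := le_sqrt_of_sq_le (by nlinarith)
    have h₂ := real_inner_le_norm v u
    nlinarith [norm_nonneg u]
  have hscale (u : EuclideanSpace ℝ (Fin 3)) :
      (√(1 + (∑ i, u i ^ 2) / c ^ 2) - (∑ i, y i * u i) / c ^ 2) ^ (-(2 * lam)) =
        c ^ (2 * lam) * (√(c ^ 2 + ‖u‖ ^ 2) - inner ℝ v u) ^ (-(2 * lam)) := by
    have h₁ : √(1 + (∑ i, u i ^ 2) / c ^ 2) = c⁻¹ * √(c ^ 2 + ‖u‖ ^ 2) := by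
      rw [EuclideanSpace.real_norm_sq_eq, ← sqrt_sq (inv_pos.2 hc).le,
        ← sqrt_mul (by positivity)]
      congr 1
      field_simp
    have h₂ : (∑ i, y i * u i) / c ^ 2 = c⁻¹ * inner ℝ v u := by
      simp only [hv, PiLp.inner_apply, Finset.sum_div, Finset.mul_sum]
      refine Finset.sum_congr rfl fun i _ => ?_
      simp
      field_simp
    rw [h₁, h₂, ← mul_sub, mul_rpow (inv_pos.2 hc).le (henergy u), inv_rpow hc.le,
      rpow_neg hc.le, inv_inv]
  have hkey : ∫⁻ u : EuclideanSpace ℝ (Fin 3),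
      ENNReal.ofReal ((√(c ^ 2 + ‖u‖ ^ 2) - inner ℝ v u) ^ (-(2 * lam))) =
        ENNReal.ofReal ((1 - ‖v‖ ^ 2) ^ (-(lam + 1 / 2)) *
          (π ^ (3 / 2 : ℝ) * (c ^ 2) ^ (-(lam - 3 / 2)) * Gamma (lam - 3 / 2) / Gamma lam)) := by
    have hrest := lintegral_sq_add_sq_norm_rpow_neg (V := EuclideanSpace ℝ (Fin 3)) (lam := lam)
      hc (by simpa using hlam)
    simp only [finrank_euclideanSpace, Fintype.card_fin, Nat.cast_ofNat] at hrest
    rw [lintegral_euclideanSpace_boost hc hvlt, ENNReal.ofReal_mul (by positivity), ← hrest]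
    congr 3
    · ring_nf
    · funext u
      rw [sqrt_eq_rpow, ← rpow_mul (by positivity)]
      ring_nf
  rw [← (PiLp.volume_preserving_ofLp (Fin 3)).integral_comp
    (MeasurableEquiv.toLp 2 (Fin 3 → ℝ)).symm.measurableEmbedding]
  simp_rw [hscale]
  rw [integral_const_mul, integral_eq_lintegral_of_nonneg_ae
    (.of_forall fun u => rpow_nonneg (henergy u) _)
    (Measurable.aestronglyMeasurable (by fun_prop)), hkey, ENNReal.toReal_ofReal (by positivity),
    ← hvsq, rpow_neg hpos.le, ← rpow_natCast c 2, ← rpow_mul hc.le]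
  have hcpow : c ^ (2 * lam) * c ^ (((2 : ℕ) : ℝ) * -(lam - 3 / 2)) = c ^ 3 := by
    rw [← rpow_add hc, ← rpow_natCast c 3]
    congr 1
    push_cast
    ring
  rw [← hcpow]
  field_simp
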